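/- Let T > 0 and let σ₊, σ₋ : [0,T] × ℝ² → ℝ be a smooth solution of the unscreened right-handed system ∂ₜσ₊ − 𝕌(σ₋)·∇σ₊ = 0, ∂ₜσ₋ + 𝕌(σ₊)·∇σ₋ = 0, with σ±(t,·) compactly supported for each t. Assume that for all t ∈ [0,T]: (i) the symmetry conditions σ±(t, x₁, x₂) = −σ±(t, −x₁, x₂) and σ₊(t, x₁, x₂) = σ₋(t, x₁, −x₂) hold; (ii) {x : |σ₊(t,x)| > 0} ⊂ {x₂ > 0}; (iii) σ₊(t,·) is either nonpositive on Q or nonnegative on Q. Then E₁(t) := ∫_Q x₁ σ₊(t,x) dx is differentiable in t and E₁′(t) = (2/π) ∫_{Q×Q} [ x₁ y₁ (x₂ + y₂) / ( |x − ȳ|² |x + y|² ) ] σ₊(t,y) σ₊(t,x) dy dx, where ȳ = (y₁, −y₂); moreover E₁′(t) > 0 whenever σ₊(t,·) is not identically zero on Q. -/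

import Mathlib

open MeasureTheory ENNReal Set Real

noncomputable section

/-- The perpendicular rotation `(z₁, z₂)^⊥ = (−z₂, z₁)` in the plane. -/
def perp (z : EuclideanSpace ℝ (Fin 2)) : EuclideanSpace ℝ (Fin 2) :=
  (WithLp.equiv 2 (Fin 2 → ℝ)).symm ![-(z 1), z 0]

/-- The Biot–Savart velocity `𝕌(ω)(x) = (1/2π) ∫ ((x−y)^⊥/|x−y|²) ω(y) dy`. -/
def biotSavart (ω : EuclideanSpace ℝ (Fin 2) → ℝ) (x : EuclideanSpace ℝ (Fin 2)) :
    EuclideanSpace ℝ (Fin 2) :=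
  (1 / (2 * Real.pi)) • ∫ y, (ω y / ‖x - y‖ ^ 2) • perp (x - y)

/-- Reflection across the `x₁`-axis: `(x₁, x₂) ↦ (x₁, −x₂)`. -/
def reflect₂ (x : EuclideanSpace ℝ (Fin 2)) : EuclideanSpace ℝ (Fin 2) :=
  (WithLp.equiv 2 (Fin 2 → ℝ)).symm ![x 0, -(x 1)]

/-- Reflection across the `x₂`-axis: `(x₁, x₂) ↦ (−x₁, x₂)`. -/
def reflect₁ (x : EuclideanSpace ℝ (Fin 2)) : EuclideanSpace ℝ (Fin 2) :=
  (WithLp.equiv 2 (Fin 2 → ℝ)).symm ![-(x 0), x 1]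

/-- The open first quadrant `Q = (0,∞)²`. -/
def Quadrant : Set (EuclideanSpace ℝ (Fin 2)) := {x | 0 < x 0 ∧ 0 < x 1}

section

open Filter Topology

local notation "Plane" => EuclideanSpace ℝ (Fin 2)

/-- `f` vanishes outside the closed ball of radius `r`. -/
def VanishesBeyond {E : Type*} [Norm E] (f : E → ℝ) (r : ℝ) : Prop :=
  ∀ x, r < ‖x‖ → f x = 0

theorem VanishesBeyond.mono {E : Type*} [Norm E] {f : E → ℝ} {r r' : ℝ}
    (h : VanishesBeyond f r) (hr : r ≤ r') : VanishesBeyond f r' :=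
  fun x hx => h x (hr.trans_lt hx)

/-- `σ` solves, at the times in `J`, a transport equation whose velocity is controlled by the
supremum of `|σ|` times the radius of its support. -/
def SelfTransported {E : Type*} [NormedAddCommGroup E] [NormedSpace ℝ E]
    (σ : ℝ → E → ℝ) (C : ℝ) (J : Set ℝ) : Prop :=
  ∀ t ∈ J, ∃ u : E → E,
    (∀ x, deriv (fun s => σ s x) t = fderiv ℝ (σ t) x (u x)) ∧
    ∀ A ρ, 0 < ρ → (∀ x, |σ t x| ≤ A) → VanishesBeyond (σ t) ρ → ∀ x, ‖u x‖ ≤ C * A * ρ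

section Transport

variable {E : Type*} [NormedAddCommGroup E] [InnerProductSpace ℝ E]

/-- Exponential barrier for transport equations with bounded velocity. -/
theorem transport_le_barrier [FiniteDimensional ℝ E] {σ : ℝ → E → ℝ}
    (hσ : ContDiff ℝ 1 fun p : ℝ × E => σ p.1 p.2) {u : ℝ → E → E} {a b M A R ρ k : ℝ} {e : E}
    (hu : ∀ t ∈ Icc a b, ∀ x, deriv (fun s => σ s x) t = fderiv ℝ (σ t) x (u t x))
    (hM : ∀ t ∈ Icc a b, ∀ x, ‖u t x‖ ≤ M)
    (hρ : ∀ t ∈ Icc a b, VanishesBeyond (σ t) ρ)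
    (hA0 : 0 ≤ A) (hA : ∀ x, σ a x ≤ A) (hR : VanishesBeyond (σ a) R)
    (hk : 0 ≤ k) (he : ‖e‖ ≤ 1) {t : ℝ} (ht : t ∈ Icc a b) (x : E) :
    σ t x ≤ A * Real.exp (-k * (inner ℝ e x - R - M * (t - a))) := by
  set ψ : ℝ → E → ℝ := fun t x => A * Real.exp (-k * (inner ℝ e x - R - M * (t - a))) with hψ
  have hψ0 : ∀ t x, 0 ≤ ψ t x := fun t x => mul_nonneg hA0 (Real.exp_pos _).le
  have key : ∀ ε > 0, σ t x - ψ t x - ε * (t - a) ≤ 0 := by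
    intro ε hε
    by_contra! hpos
    set f : ℝ × E → ℝ := fun p => σ p.1 p.2 - ψ p.1 p.2 - ε * (p.1 - a) with hf
    have hfc : Continuous f := by
      have := hσ.continuous
      simp only [hf, hψ]
      fun_prop
    obtain ⟨p, hpK, hpmax⟩ := ((isCompact_Icc (a := a) (b := b)).prod
      (isCompact_closedBall (0 : E) (max ρ ‖x‖))).exists_isMaxOn
        ⟨(t, x), ⟨ht, by simp⟩⟩ hfc.continuousOn
    have hfp : 0 < f p := hpos.trans_le (hpmax (a := (t, x)) ⟨ht, by simp⟩)
    have hglob : ∀ q : ℝ × E, q.1 ∈ Icc a b → f q ≤ f p := by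
      intro q hq
      by_cases hqn : ‖q.2‖ ≤ ρ
      · exact hpmax ⟨hq, by simp [hqn]⟩
      · have h1 : σ q.1 q.2 = 0 := hρ _ hq _ (not_le.1 hqn)
        have h2 := mul_nonneg hε.le (sub_nonneg.2 hq.1)
        have h3 := hψ0 q.1 q.2
        simp only [hf] at hfp ⊢
        linarith
    obtain ⟨⟨hpa, hpb⟩, -⟩ := hpK
    have hap : a < p.1 := by
      refine lt_of_le_of_ne hpa fun h => hfp.not_ge ?_
      simp only [hf, ← h]
      have : σ a p.2 ≤ ψ a p.2 := by
        by_cases hx : R < ‖p.2‖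
        · rw [hR _ hx]; exact hψ0 _ _
        · refine (hA _).trans (le_mul_of_one_le_right hA0 (Real.one_le_exp ?_))
          have : inner ℝ e p.2 ≤ R :=
            (real_inner_le_norm _ _).trans
              ((mul_le_of_le_one_left (norm_nonneg _) he).trans (not_lt.1 hx))
          nlinarith
      linarith
    have hσx : DifferentiableAt ℝ (σ p.1) p.2 :=
      ((hσ.comp (contDiff_const.prodMk contDiff_id)).differentiable one_ne_zero) p.2
    have hσt : DifferentiableAt ℝ (fun s => σ s p.2) p.1 :=
      ((hσ.comp (contDiff_id.prodMk contDiff_const)).differentiable one_ne_zero) p.1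
    have hψx : HasFDerivAt (ψ p.1) ((-k * ψ p.1 p.2) • innerSL ℝ e) p.2 := by
      have h1 : HasFDerivAt (fun y : E => inner ℝ e y) (innerSL ℝ e) p.2 :=
        (innerSL ℝ e).hasFDerivAt
      have h2 := ((((h1.sub_const R).sub_const (M * (p.1 - a))).const_mul (-k)).exp).const_mul A
      refine h2.congr_fderiv ?_
      simp only [smul_smul, hψ]
      congr 1
      ring
    have hψt : HasDerivAt (fun s => ψ s p.2) (k * M * ψ p.1 p.2) p.1 := by
      have h1 : HasDerivAt (fun s : ℝ => M * (s - a)) (M * 1) p.1 :=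
        ((hasDerivAt_id p.1).sub_const a).const_mul M
      have h2 := (((h1.const_sub (inner ℝ e p.2 - R)).const_mul (-k)).exp).const_mul A
      refine h2.congr_deriv ?_
      simp only [hψ]
      ring
    have hgrad : fderiv ℝ (σ p.1) p.2 = (-k * ψ p.1 p.2) • innerSL ℝ e := by
      have hmax : IsLocalMax (fun y => f (p.1, y)) p.2 :=
        Eventually.of_forall fun y => hglob (p.1, y) ⟨hpa, hpb⟩
      have := hmax.hasFDerivAt_eq_zero ((hσx.hasFDerivAt.sub hψx).sub_const (ε * (p.1 - a)))
      exact sub_eq_zero.1 this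
    have htime : 0 ≤ deriv (fun s => σ s p.2) p.1 - k * M * ψ p.1 p.2 - ε * 1 := by
      have hd : HasDerivAt (fun s => f (s, p.2))
          (deriv (fun s => σ s p.2) p.1 - k * M * ψ p.1 p.2 - ε * 1) p.1 :=
        (hσt.hasDerivAt.sub hψt).sub (((hasDerivAt_id p.1).sub_const a).const_mul ε)
      have hmax : IsLocalMaxOn (fun s => f (s, p.2)) (Icc a b) p.1 :=
        (show IsMaxOn (fun s => f (s, p.2)) (Icc a b) p.1 from
          fun s hs => hglob (s, p.2) hs).localize
      have := hmax.hasFDerivWithinAt_nonpos hd.hasDerivWithinAt.hasFDerivWithinAt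
        (y := a - p.1) (sub_mem_posTangentConeAt_of_segment_subset
          ((convex_Icc a b).segment_subset ⟨hpa, hpb⟩ ⟨le_rfl, hpa.trans hpb⟩))
      simp only [ContinuousLinearMap.toSpanSingleton_apply, smul_eq_mul] at this
      nlinarith
    have h5 : -inner ℝ e (u p.1 p.2) ≤ M :=
      (neg_le_abs _).trans ((abs_real_inner_le_norm _ _).trans
        ((mul_le_of_le_one_left (norm_nonneg _) he).trans (hM _ ⟨hpa, hpb⟩ _)))
    rw [hu _ ⟨hpa, hpb⟩, hgrad] at htime
    simp only [smul_apply, innerSL_apply_apply, smul_eq_mul] at htime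
    nlinarith [mul_le_mul_of_nonneg_left h5 (mul_nonneg hk (hψ0 p.1 p.2))]
  have hlim : Tendsto (fun ε : ℝ => σ t x - ψ t x - ε * (t - a)) (𝓝[>] 0)
      (𝓝 (σ t x - ψ t x - 0 * (t - a))) :=
    (Continuous.tendsto (by fun_prop) _).mono_left nhdsWithin_le_nhds
  have := le_of_tendsto hlim (eventually_nhdsWithin_of_forall key)
  simp only [zero_mul, sub_zero] at this
  exact sub_nonpos.1 this

/-- Maximum principle and finite speed of propagation for transport equations. -/
theorem transport_abs_le_and_vanishesBeyond [FiniteDimensional ℝ E] {σ : ℝ → E → ℝ}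
    (hσ : ContDiff ℝ 1 fun p : ℝ × E => σ p.1 p.2) {u : ℝ → E → E} {a b M A R ρ : ℝ}
    (hu : ∀ t ∈ Icc a b, ∀ x, deriv (fun s => σ s x) t = fderiv ℝ (σ t) x (u t x))
    (hM : ∀ t ∈ Icc a b, ∀ x, ‖u t x‖ ≤ M)
    (hρ : ∀ t ∈ Icc a b, VanishesBeyond (σ t) ρ)
    (hA : ∀ x, |σ a x| ≤ A) (hR0 : 0 ≤ R) (hR : VanishesBeyond (σ a) R)
    {t : ℝ} (ht : t ∈ Icc a b) :
    (∀ x, |σ t x| ≤ A) ∧ VanishesBeyond (σ t) (R + M * (t - a)) := by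
  have hA0 : 0 ≤ A := (abs_nonneg _).trans (hA 0)
  have hM0 : 0 ≤ M := (norm_nonneg _).trans (hM t ht 0)
  have key : ∀ k : ℝ, 0 ≤ k → ∀ e : E, ‖e‖ ≤ 1 → ∀ x,
      |σ t x| ≤ A * Real.exp (-k * (inner ℝ e x - R - M * (t - a))) := by
    intro k hk e he x
    refine abs_le.2 ⟨?_, transport_le_barrier hσ hu hM hρ hA0 (fun y => (abs_le.1 (hA y)).2)
      hR hk he ht x⟩
    have := transport_le_barrier (σ := fun t x => -σ t x) (u := u) (ρ := ρ) (R := R) hσ.neg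
      (fun s hs y => by
        have h1 : (fun x => -σ s x) = -(σ s) := rfl
        have h2 : (fun r => -σ r y) = -(fun r => σ r y) := rfl
        rw [h1, h2, fderiv_neg, deriv.neg, hu s hs y]; rfl) hM
      (fun s hs y hy => by simp [hρ s hs y hy]) hA0
      (fun y => neg_le.1 (abs_le.1 (hA y)).1) (fun y hy => by simp [hR y hy]) hk he ht x
    linarith
  refine ⟨fun x => by simpa using key 0 le_rfl 0 (by simp) x, fun x hx => ?_⟩
  have hx0 : 0 < ‖x‖ :=
    lt_of_le_of_lt (add_nonneg hR0 (mul_nonneg hM0 (sub_nonneg.2 ht.1))) hx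
  have hin : inner ℝ (‖x‖⁻¹ • x) x = ‖x‖ := by
    rw [real_inner_smul_left, real_inner_self_eq_norm_sq]
    field_simp
  have hle : ∀ k : ℝ, 0 ≤ k → |σ t x| ≤ A * Real.exp (-(k * (‖x‖ - R - M * (t - a)))) := by
    intro k hk
    have := key k hk (‖x‖⁻¹ • x) (by rw [norm_smul, norm_inv, norm_norm, inv_mul_cancel₀ hx0.ne']) x
    rwa [hin, neg_mul] at this
  have hlim : Tendsto (fun k : ℝ => A * Real.exp (-(k * (‖x‖ - R - M * (t - a))))) atTop
      (𝓝 (A * 0)) :=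
    (Real.tendsto_exp_neg_atTop_nhds_zero.comp
      (tendsto_id.atTop_mul_const (by linarith))).const_mul A
  rw [mul_zero] at hlim
  exact abs_nonpos_iff.1 (ge_of_tendsto hlim ((eventually_ge_atTop 0).mono hle))

end Transport

theorem isClosed_setOf_vanishesBeyond {E : Type*} [NormedAddCommGroup E] {σ : ℝ → E → ℝ}
    (hσ : Continuous fun p : ℝ × E => σ p.1 p.2) (ρ : ℝ) :
    IsClosed {t | VanishesBeyond (σ t) ρ} := by
  simp only [VanishesBeyond, ofPred_forall]
  exact isClosed_iInter fun x => isClosed_iInter fun _ =>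
    isClosed_eq (hσ.comp (by fun_prop : Continuous fun t : ℝ => (t, x))) continuous_const

theorem SelfTransported.mono {E : Type*} [NormedAddCommGroup E] [NormedSpace ℝ E]
    {σ : ℝ → E → ℝ} {C : ℝ} {J J' : Set ℝ} (h : SelfTransported σ C J)
    (hJ : J' ⊆ J) : SelfTransported σ C J' :=
  fun t ht => h t (hJ ht)

theorem SelfTransported.comp_neg {E : Type*} [NormedAddCommGroup E] [NormedSpace ℝ E]
    {σ : ℝ → E → ℝ} {C : ℝ} {J J' : Set ℝ}
    (h : SelfTransported σ C J) (hJ : ∀ t ∈ J', -t ∈ J) :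
    SelfTransported (fun t => σ (-t)) C J' := by
  intro t ht
  obtain ⟨u, hu, hb⟩ := h (-t) (hJ t ht)
  refine ⟨fun x => -u x, fun x => ?_, fun A ρ hρ hA hv x => ?_⟩
  · rw [deriv_comp_neg (fun s => σ s x), hu, map_neg]
  · rw [norm_neg]
    exact hb A ρ hρ hA hv x

theorem exists_vanishesBeyond_of_locally {E : Type*} [NormedAddCommGroup E] {σ : ℝ → E → ℝ}
    {J : Set ℝ} (hJ : IsCompact J)
    (h : ∀ t ∈ J, ∃ r, ∀ᶠ s in 𝓝[J] t, VanishesBeyond (σ s) r) :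
    ∃ r, ∀ t ∈ J, VanishesBeyond (σ t) r := by
  refine hJ.induction_on (p := fun S => ∃ r, ∀ t ∈ S, VanishesBeyond (σ t) r) ⟨0, by simp⟩
    (fun S S' hS ⟨r, hr⟩ => ⟨r, fun t ht => hr t (hS ht)⟩) ?_ ?_
  · rintro S S' ⟨r, hr⟩ ⟨r', hr'⟩
    refine ⟨max r r', fun t ht => ht.elim (fun ht => (hr t ht).mono (le_max_left _ _))
      fun ht => (hr' t ht).mono (le_max_right _ _)⟩
  · intro t ht
    obtain ⟨r, hr⟩ := h t ht
    exact ⟨_, hr, r, fun s hs => hs⟩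

section SelfTransport

variable {E : Type*} [NormedAddCommGroup E] [InnerProductSpace ℝ E] [FiniteDimensional ℝ E]

theorem exists_forall_abs_le_of_vanishesBeyond {σ : ℝ → E → ℝ}
    (hσ : Continuous fun p : ℝ × E => σ p.1 p.2) {J : Set ℝ} (hJ : IsCompact J) (ρ : ℝ) :
    ∃ A, ∀ t ∈ J, VanishesBeyond (σ t) ρ → ∀ x, |σ t x| ≤ A := by
  obtain ⟨A, hA⟩ := (hJ.prod (isCompact_closedBall (0 : E) ρ)).exists_bound_of_continuousOn
    hσ.continuousOn
  refine ⟨max A 0, fun t ht h x => ?_⟩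
  by_cases hx : ρ < ‖x‖
  · simp [h x hx]
  · exact (hA (t, x) ⟨ht, by simpa using hx⟩).trans (le_max_left _ _)

theorem SelfTransported.abs_le {σ : ℝ → E → ℝ}
    (hσ : ContDiff ℝ 1 fun p : ℝ × E => σ p.1 p.2) {C a b A ρ : ℝ}
    (h : SelfTransported σ C (Icc a b))
    (hρ : ∀ t ∈ Icc a b, VanishesBeyond (σ t) ρ) (hA : ∀ x, |σ a x| ≤ A)
    {t : ℝ} (ht : t ∈ Icc a b) (x : E) : |σ t x| ≤ A := by
  obtain ⟨A', hA'⟩ := exists_forall_abs_le_of_vanishesBeyond hσ.continuous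
    (isCompact_Icc (a := a) (b := b)) ρ
  choose! u hu hb using h
  have hρ' : ∀ t ∈ Icc a b, VanishesBeyond (σ t) (max ρ 1) :=
    fun t ht => (hρ t ht).mono (le_max_left _ _)
  exact (transport_abs_le_and_vanishesBeyond hσ hu
    (fun t ht => hb t ht A' (max ρ 1) (by positivity) (hA' t ht (hρ t ht)) (hρ' t ht)) hρ' hA
    (le_max_of_le_right zero_le_one) (hρ' a ⟨le_rfl, ht.1.trans ht.2⟩) ht).1 x

theorem SelfTransported.vanishesBeyond {σ : ℝ → E → ℝ}
    (hσ : ContDiff ℝ 1 fun p : ℝ × E => σ p.1 p.2) {C a b A R ρ : ℝ} (hC : 0 ≤ C)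
    (h : SelfTransported σ C (Icc a b))
    (hρ : ∀ t ∈ Icc a b, VanishesBeyond (σ t) ρ) (hA : ∀ x, |σ a x| ≤ A)
    (hR0 : 0 < R) (hR : VanishesBeyond (σ a) R) (hsmall : C * A * (b - a) ≤ 1 / 2)
    {t : ℝ} (ht : t ∈ Icc a b) : VanishesBeyond (σ t) (2 * R) := by
  have hA0 : 0 ≤ A := (abs_nonneg _).trans (hA 0)
  have hAt := fun t ht x => SelfTransported.abs_le hσ h hρ hA (t := t) ht x
  choose! u hu hb using h
  have step : ∀ r, 0 < r → (∀ t ∈ Icc a b, VanishesBeyond (σ t) r) →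
      ∀ t ∈ Icc a b, VanishesBeyond (σ t) (R + r / 2) := by
    intro r hr hv t ht
    refine (transport_abs_le_and_vanishesBeyond hσ hu
      (fun t ht => hb t ht A r hr (hAt t ht) (hv t ht)) hv hA hR0.le hR ht).2.mono ?_
    have h1 : C * A * (t - a) ≤ 1 / 2 :=
      (mul_le_mul_of_nonneg_left (by linarith [ht.2]) (by positivity)).trans hsmall
    nlinarith
  have hd : 0 ≤ max ρ (2 * R) - 2 * R := sub_nonneg.2 (le_max_right _ _)
  have iter : ∀ n : ℕ, ∀ t ∈ Icc a b,
      VanishesBeyond (σ t) (2 * R + (max ρ (2 * R) - 2 * R) * (1 / 2) ^ n) := by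
    intro n
    induction n with
    | zero => exact fun t ht => (hρ t ht).mono (by simp)
    | succ n ih =>
      refine fun t ht => (step _ (by positivity) ih t ht).mono (le_of_eq ?_)
      ring
  intro x hx
  have hlim : Tendsto (fun n : ℕ => 2 * R + (max ρ (2 * R) - 2 * R) * (1 / 2 : ℝ) ^ n) atTop
      (𝓝 (2 * R + (max ρ (2 * R) - 2 * R) * 0)) :=
    ((_root_.tendsto_pow_atTop_nhds_zero_of_lt_one (by norm_num)
      (by norm_num)).const_mul _).const_add _
  rw [mul_zero, add_zero] at hlim
  obtain ⟨n, hn⟩ := (hlim.eventually (gt_mem_nhds hx)).exists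
  exact iter n t ht x hn

/-- The support cannot come in from infinity: a bound on the support at time `a` gives a bound at a
slightly later time `b`, even if the supports are only locally bounded on `(a, b]`. -/
theorem SelfTransported.vanishesBeyond_of_Ioc {σ : ℝ → E → ℝ}
    (hσ : ContDiff ℝ 1 fun p : ℝ × E => σ p.1 p.2) {C a b A R : ℝ} (hC : 0 ≤ C) (hab : a < b)
    (h : SelfTransported σ C (Icc a b))
    (hloc : ∀ s ∈ Ioc a b, ∃ r, ∀ t ∈ Icc s b, VanishesBeyond (σ t) r)
    (hA : ∀ x, |σ a x| ≤ A) (hR0 : 0 < R) (hR : VanishesBeyond (σ a) R)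
    (hsmall : C * A * (b - a) ≤ 1 / 2) : VanishesBeyond (σ b) (2 * R) := by
  have hσ' : ContDiff ℝ 1 fun p : ℝ × E => σ (-p.1) p.2 :=
    hσ.comp ((contDiff_fst.neg).prodMk contDiff_snd)
  obtain ⟨A', hA'⟩ : ∃ A', ∀ x, |σ b x| ≤ A' := by
    obtain ⟨r, hr⟩ := hloc b ⟨hab, le_rfl⟩
    obtain ⟨A', hA'⟩ := exists_forall_abs_le_of_vanishesBeyond hσ.continuous
      (isCompact_singleton (x := b)) r
    exact ⟨A', hA' b rfl (hr b ⟨le_rfl, le_rfl⟩)⟩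
  have hA'0 : 0 ≤ A' := (abs_nonneg _).trans (hA' 0)
  have hback : ∀ s ∈ Ioc a b, ∀ x, |σ s x| ≤ A' := by
    intro s hs x
    obtain ⟨r, hr⟩ := hloc s hs
    have := SelfTransported.abs_le (σ := fun t => σ (-t)) (a := -b) (b := -s) (ρ := r) (A := A') hσ'
      (h.comp_neg fun t ht => ⟨by linarith [ht.2, hs.1], by linarith [ht.1]⟩)
      (fun t ht => hr (-t) ⟨by linarith [ht.2], by linarith [ht.1]⟩)
      (by simpa using hA') (t := -s) ⟨by linarith [hs.2], le_rfl⟩ x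
    simpa using this
  set c := min b (a + 1 / (2 * (C * A' + 1))) with hc
  have hac : a < c := lt_min hab (by have : 0 < 1 / (2 * (C * A' + 1)) := by positivity
                                     linarith)
  have hcb : c ≤ b := min_le_left _ _
  have hca : C * A' * (c - a) ≤ 1 / 2 := by
    have h1 : c - a ≤ 1 / (2 * (C * A' + 1)) := by
      linarith [min_le_right b (a + 1 / (2 * (C * A' + 1)))]
    refine (mul_le_mul_of_nonneg_left h1 (by positivity)).trans ?_
    rw [mul_one_div, div_le_div_iff₀ (by positivity) (by norm_num)]
    linarith
  obtain ⟨r, hr⟩ := hloc c ⟨hac, hcb⟩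
  set r' := max r 1
  have hr' : ∀ t ∈ Icc c b, VanishesBeyond (σ t) r' := fun t ht => (hr t ht).mono (le_max_left _ _)
  have hr'0 : 0 < r' := lt_max_of_lt_right one_pos
  have hnear : ∀ s ∈ Ioc a c, VanishesBeyond (σ s) (2 * r') := by
    intro s hs
    obtain ⟨q, hq⟩ := hloc s ⟨hs.1, hs.2.trans hcb⟩
    have := SelfTransported.vanishesBeyond (σ := fun t => σ (-t)) (a := -c) (b := -s) (ρ := q)
      (R := r') (A := A') hσ' hC
      (h.comp_neg fun t ht => ⟨by linarith [ht.2, hs.1], by linarith [ht.1]⟩)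
      (fun t ht => hq (-t) ⟨by linarith [ht.2], by linarith [ht.1]⟩)
      (by simpa using hback c ⟨hac, hcb⟩) hr'0 (by simpa using hr' c ⟨le_rfl, hcb⟩)
      ((mul_le_mul_of_nonneg_left (by linarith [hs.1]) (by positivity)).trans hca)
      (t := -s) ⟨by linarith [hs.2], le_rfl⟩
    simpa using this
  refine SelfTransported.vanishesBeyond (ρ := max R (2 * r')) hσ hC h (fun t ht => ?_) hA hR0 hR
    hsmall ⟨hab.le, le_rfl⟩
  rcases ht.1.eq_or_lt with rfl | hat
  · exact hR.mono (le_max_left _ _)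
  rcases le_total t c with htc | htc
  · exact (hnear t ⟨hat, htc⟩).mono (le_max_right _ _)
  · exact (hr' t ⟨htc, ht.2⟩).mono (le_max_of_le_right (by linarith))

/-- Pointwise in time compact supports of a self-transported smooth function on a compact time
interval are uniformly bounded. -/
theorem SelfTransported.exists_vanishesBeyond {σ : ℝ → E → ℝ}
    (hσ : ContDiff ℝ 1 fun p : ℝ × E => σ p.1 p.2) {C a b : ℝ} (hC : 0 ≤ C)
    (h : SelfTransported σ C (Icc a b))
    (hloc : ∀ t ∈ Icc a b, ∃ r, VanishesBeyond (σ t) r) :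
    ∃ r, ∀ t ∈ Icc a b, VanishesBeyond (σ t) r := by
  refine exists_vanishesBeyond_of_locally isCompact_Icc ?_
  by_contra! hcon
  set B : Set ℝ := {t ∈ Icc a b | ∀ r, ∃ᶠ s in 𝓝[Icc a b] t, ¬ VanishesBeyond (σ s) r} with hB
  have hBclosed : IsClosed B := by
    refine isClosed_of_closure_subset fun t ht => ?_
    have htI : t ∈ Icc a b := closure_minimal (fun s hs => hs.1) isClosed_Icc ht
    refine ⟨htI, fun r hr => ?_⟩
    simp only [not_not] at hr
    have hr' := eventually_eventually_nhdsWithin.2 hr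
    rw [eventually_nhdsWithin_iff] at hr'
    obtain ⟨s, hs, hsB⟩ := mem_closure_iff_nhds.1 ht _ hr'
    exact hsB.2 r ((hs hsB.1).mono fun _ h => not_not.2 h)
  have hgood : ∀ t ∈ Icc a b, t ∉ B → ∃ r, ∀ᶠ s in 𝓝[Icc a b] t, VanishesBeyond (σ s) r := by
    intro t ht htB
    by_contra! hne
    exact htB ⟨ht, hne⟩
  have hBI : B ⊆ Icc a b := fun t ht => ht.1
  obtain ⟨tb, htb, htb'⟩ := hcon
  have : Nonempty B := ⟨⟨tb, htb, htb'⟩⟩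
  have : CompleteSpace B := hBclosed.completeSpace_coe
  obtain ⟨n, t₀, ht₀⟩ := nonempty_interior_of_iUnion_of_closed
    (f := fun n : ℕ => {t : B | VanishesBeyond (σ t) n})
    (fun n => (isClosed_setOf_vanishesBeyond hσ.continuous n).preimage continuous_subtype_val)
    (by
      refine eq_univ_of_forall fun t => mem_iUnion.2 ?_
      obtain ⟨r, hr⟩ := hloc t t.2.1
      obtain ⟨n, hn⟩ := exists_nat_ge r
      exact ⟨n, hr.mono hn⟩)
  obtain ⟨δ, hδ, hδB⟩ := Metric.mem_nhds_iff.1 (mem_interior_iff_mem_nhds.1 ht₀)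
  have hBn : ∀ s ∈ B, |s - t₀| < δ → VanishesBeyond (σ s) (n + 1) := fun s hs hst =>
    VanishesBeyond.mono (hδB (show (⟨s, hs⟩ : B) ∈ Metric.ball t₀ δ from hst)) (by simp)
  obtain ⟨A, hA⟩ := exists_forall_abs_le_of_vanishesBeyond hσ.continuous
    (isCompact_Icc (a := a) (b := b)) (n + 1)
  have hA0 : 0 ≤ A := (abs_nonneg _).trans
    (hA t₀ t₀.2.1 (hBn t₀ t₀.2 (by simpa using hδ)) 0)
  have hσ' : ContDiff ℝ 1 fun p : ℝ × E => σ (-p.1) p.2 :=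
    hσ.comp ((contDiff_fst.neg).prodMk contDiff_snd)
  have hn0 : (0 : ℝ) < n + 1 := by positivity
  set η := min δ (1 / (2 * (C * A + 1))) with hη
  have hη0 : 0 < η := lt_min hδ (by positivity)
  have hsmall : ∀ d, d < η → C * A * d ≤ 1 / 2 := by
    intro d hd
    refine (mul_le_mul_of_nonneg_left (hd.le.trans (min_le_right _ _)) (by positivity)).trans ?_
    rw [mul_one_div, div_le_div_iff₀ (by positivity) (by norm_num)]
    linarith
  have hcpt : ∀ s t, Icc s t ⊆ Icc a b → (∀ q ∈ Icc s t, q ∉ B) →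
      ∃ r, ∀ q ∈ Icc s t, VanishesBeyond (σ q) r := fun s t hst hq =>
    exists_vanishesBeyond_of_locally isCompact_Icc fun q hqm => by
      obtain ⟨r, hr⟩ := hgood q (hst hqm) (hq q hqm)
      exact ⟨r, hr.filter_mono (nhdsWithin_mono _ hst)⟩
  have hmain : ∀ t ∈ Icc a b, |t - t₀| < η → VanishesBeyond (σ t) (2 * (n + 1)) := by
    intro t ht htη
    by_cases htB : t ∈ B
    · exact (hBn t htB (htη.trans_le (min_le_left _ _))).mono (by linarith)
    rw [abs_lt] at htη
    rcases lt_or_gt_of_ne (show t ≠ t₀ from fun h => htB (h ▸ t₀.2)) with hlt | hgt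
    · obtain ⟨c, hcmem, hcle⟩ := (isCompact_Icc.inter_left hBclosed).exists_isLeast
        (s := B ∩ Icc t t₀) ⟨t₀, t₀.2, hlt.le, le_rfl⟩
      have htc : t < c := lt_of_le_of_ne hcmem.2.1 fun h => htB (h ▸ hcmem.1)
      have hsub : Icc t c ⊆ Icc a b := Icc_subset_Icc ht.1 (hBI hcmem.1).2
      have hcv := hBn c hcmem.1 (by
        rw [abs_lt]; constructor <;> linarith [hcmem.2.2, min_le_left δ (1 / (2 * (C * A + 1)))])
      have := SelfTransported.vanishesBeyond_of_Ioc (σ := fun t => σ (-t)) (a := -c) (b := -t)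
        (A := A) (R := n + 1) hσ' hC (by linarith)
        (h.comp_neg fun q hq => hsub ⟨by linarith [hq.2], by linarith [hq.1]⟩)
        (fun s hs => by
          obtain ⟨r, hr⟩ := hcpt t (-s) ((Icc_subset_Icc_right (by linarith [hs.1])).trans hsub)
            fun q hq hqB => by
              have := hcle ⟨hqB, hq.1, hq.2.trans (by linarith [hs.1, hcmem.2.2])⟩
              linarith [hq.2, hs.1]
          exact ⟨r, fun q hq => hr (-q) ⟨by linarith [hq.2], by linarith [hq.1]⟩⟩)
        (by simpa using hA c (hBI hcmem.1) hcv) hn0 (by simpa using hcv)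
        (hsmall _ (by linarith [hcmem.2.2]))
      simpa using this
    · obtain ⟨c, hcmem, hcle⟩ := (isCompact_Icc.inter_left hBclosed).exists_isGreatest
        (s := B ∩ Icc t₀ t) ⟨t₀, t₀.2, le_rfl, hgt.le⟩
      have htc : c < t := lt_of_le_of_ne hcmem.2.2 fun h => htB (h ▸ hcmem.1)
      have hsub : Icc c t ⊆ Icc a b := Icc_subset_Icc (hBI hcmem.1).1 ht.2
      have hcv := hBn c hcmem.1 (by
        rw [abs_lt]; constructor <;> linarith [hcmem.2.1, min_le_left δ (1 / (2 * (C * A + 1)))])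
      exact SelfTransported.vanishesBeyond_of_Ioc hσ hC htc (h.mono hsub)
        (fun s hs => hcpt s t ((Icc_subset_Icc_left hs.1.le).trans hsub) fun q hq hqB => by
          have := hcle ⟨hqB, hcmem.2.1.trans (hs.1.le.trans hq.1), hq.2⟩
          linarith [hq.1, hs.1])
        (hA c (hBI hcmem.1) hcv) hn0 hcv (hsmall _ (by linarith [hcmem.2.1]))
  refine t₀.2.2 (2 * (n + 1)) ?_
  simp only [not_not]
  filter_upwards [self_mem_nhdsWithin, nhdsWithin_le_nhds (Metric.ball_mem_nhds (t₀ : ℝ) hη0)]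
    with s hs hsη
  exact hmain s hs hsη

end SelfTransport

theorem Plane.norm_sq (z : Plane) : ‖z‖ ^ 2 = z 0 ^ 2 + z 1 ^ 2 := by
  simp [EuclideanSpace.real_norm_sq_eq, Fin.sum_univ_two]

@[simp] theorem perp_apply_zero (z : Plane) : perp z 0 = -(z 1) := rfl

@[simp] theorem perp_apply_one (z : Plane) : perp z 1 = z 0 := rfl

theorem perp_eq (z : Plane) :
    perp z = (-(z 1)) • EuclideanSpace.single 0 1 + z 0 • EuclideanSpace.single 1 1 := by
  ext i
  fin_cases i <;> simp

@[simp] theorem norm_perp (z : Plane) : ‖perp z‖ = ‖z‖ := by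
  rw [← sq_eq_sq₀ (norm_nonneg _) (norm_nonneg _), Plane.norm_sq, Plane.norm_sq]
  simp [add_comm]

@[fun_prop] theorem continuous_perp : Continuous perp := by
  simp only [funext perp_eq]
  fun_prop

/-- The kernel `1/|z|` truncated at radius `ρ`. -/
def truncatedInv (ρ : ℝ) (z : Plane) : ℝ := (Iio ρ).indicator (·⁻¹) ‖z‖

theorem truncatedInv_nonneg (ρ : ℝ) (z : Plane) : 0 ≤ truncatedInv ρ z := by
  rw [truncatedInv, indicator_apply]
  split_ifs <;> positivity

theorem truncatedInv_of_lt {ρ : ℝ} {z : Plane} (h : ‖z‖ < ρ) : truncatedInv ρ z = ‖z‖⁻¹ :=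
  indicator_of_mem (s := Iio ρ) h _

theorem pow_smul_truncated_eq (ρ : ℝ) : EqOn
    (fun y : ℝ => y ^ (Module.finrank ℝ Plane - 1) • (Iio ρ).indicator (·⁻¹) y)
    ((Iio ρ).indicator 1) (Ioi 0) := by
  intro y (hy : 0 < y)
  by_cases h : y < ρ <;> simp [h, hy.ne']

theorem integrable_truncatedInv (ρ : ℝ) : Integrable (truncatedInv ρ) := by
  refine (integrable_fun_norm_addHaar volume (f := (Iio ρ).indicator (·⁻¹))).2 ?_
  rw [integrableOn_congr_fun (pow_smul_truncated_eq ρ) measurableSet_Ioi,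
    IntegrableOn, integrable_indicator_iff measurableSet_Iio, IntegrableOn,
    Measure.restrict_restrict measurableSet_Iio, inter_comm, Ioi_inter_Iio]
  exact integrableOn_const (by simp)

theorem integral_truncatedInv {ρ : ℝ} (hρ : 0 ≤ ρ) : ∫ z, truncatedInv ρ z = 2 * π * ρ := by
  have h := integral_fun_norm_addHaar (volume : Measure Plane) ((Iio ρ).indicator (·⁻¹))
  rw [setIntegral_congr_fun measurableSet_Ioi (pow_smul_truncated_eq ρ),
    setIntegral_indicator measurableSet_Iio, Ioi_inter_Iio] at h
  simp only [truncatedInv]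
  rw [h]
  simp [Measure.real, hρ, mul_assoc, pi_pos.le]

theorem Plane.volume_real_closedBall {ρ : ℝ} (hρ : 0 ≤ ρ) :
    volume.real (Metric.closedBall (0 : Plane) ρ) = π * ρ ^ 2 := by
  simp [Measure.real, hρ, mul_comm, pi_pos.le]

theorem norm_smul_perp (c : ℝ) (z : Plane) : ‖(c / ‖z‖ ^ 2) • perp z‖ = |c| * ‖z‖⁻¹ := by
  rw [norm_smul, norm_perp, norm_div, norm_pow, norm_norm, Real.norm_eq_abs]
  rcases eq_or_ne ‖z‖ 0 with h | h
  · simp [h]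
  · field_simp

theorem norm_biotSavart_integrand_le {ω : Plane → ℝ} {A ρ : ℝ} (hρ : 0 < ρ)
    (hA : ∀ y, |ω y| ≤ A) (hv : VanishesBeyond ω ρ) (x y : Plane) :
    ‖(ω y / ‖x - y‖ ^ 2) • perp (x - y)‖ ≤
      A * (truncatedInv ρ (x - y) + (Metric.closedBall 0 ρ).indicator (fun _ => ρ⁻¹) y) := by
  have hA0 : 0 ≤ A := (abs_nonneg _).trans (hA 0)
  rw [norm_smul_perp]
  by_cases hy : ρ < ‖y‖
  · rw [hv y hy, abs_zero, zero_mul]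
    exact mul_nonneg hA0 (add_nonneg (truncatedInv_nonneg _ _)
      (indicator_nonneg (fun _ _ => by positivity) _))
  refine mul_le_mul (hA y) ?_ (by positivity) hA0
  rw [indicator_of_mem (by simpa using hy)]
  by_cases hxy : ‖x - y‖ < ρ
  · rw [truncatedInv_of_lt hxy]
    exact le_add_of_nonneg_right (by positivity)
  · exact (inv_anti₀ hρ (not_lt.1 hxy)).trans (le_add_of_nonneg_left (truncatedInv_nonneg _ _))

theorem integrable_biotSavart_bound (A ρ : ℝ) (x : Plane) : Integrable fun y : Plane =>
    A * (truncatedInv ρ (x - y) + (Metric.closedBall 0 ρ).indicator (fun _ => ρ⁻¹) y) :=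
  (((integrable_truncatedInv ρ).comp_sub_left x).add
    ((integrable_indicator_iff Metric.isClosed_closedBall.measurableSet).2
      (integrableOn_const measure_closedBall_lt_top.ne))).const_mul A

theorem norm_biotSavart_le {ω : Plane → ℝ} {A ρ : ℝ} (hρ : 0 < ρ)
    (hA : ∀ y, |ω y| ≤ A) (hv : VanishesBeyond ω ρ) (x : Plane) :
    ‖biotSavart ω x‖ ≤ 3 / 2 * A * ρ := by
  have h := norm_integral_le_of_norm_le (integrable_biotSavart_bound A ρ x)
    (Eventually.of_forall (norm_biotSavart_integrand_le hρ hA hv x))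
  rw [integral_const_mul, integral_add ((integrable_truncatedInv ρ).comp_sub_left x)
    ((integrable_indicator_iff Metric.isClosed_closedBall.measurableSet).2
      (integrableOn_const measure_closedBall_lt_top.ne)),
    integral_sub_left_eq_self (truncatedInv ρ) volume x, integral_truncatedInv hρ.le,
    integral_indicator Metric.isClosed_closedBall.measurableSet, setIntegral_const,
    Plane.volume_real_closedBall hρ.le] at h
  rw [biotSavart, norm_smul, Real.norm_of_nonneg (by positivity)]
  refine (mul_le_mul_of_nonneg_left h (by positivity)).trans (le_of_eq ?_)
  rw [smul_eq_mul]
  field_simp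
  norm_num

theorem HasCompactSupport.exists_vanishesBeyond {f : Plane → ℝ} (h : HasCompactSupport f) :
    ∃ r, VanishesBeyond f r := by
  obtain ⟨r, hr⟩ := h.isBounded.exists_norm_le
  exact ⟨r, fun x hx => by_contra fun hne => (hr x (subset_tsupport f hne)).not_gt hx⟩

theorem integrable_biotSavart_integrand {ω : Plane → ℝ} (hω : Continuous ω)
    (hc : HasCompactSupport ω) (x : Plane) :
    Integrable fun y => (ω y / ‖x - y‖ ^ 2) • perp (x - y) := by
  obtain ⟨A, hA⟩ := hω.bounded_above_of_compact_support hc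
  obtain ⟨r, hr⟩ := hc.exists_vanishesBeyond
  refine (integrable_biotSavart_bound A (max r 1) x).mono' ?_ (Eventually.of_forall
    (norm_biotSavart_integrand_le (by positivity) hA (hr.mono (le_max_left _ _)) x))
  have hm : Measurable fun y => perp (x - y) := (by fun_prop : Continuous _).measurable
  exact ((hω.measurable.div (by fun_prop)).smul hm).aestronglyMeasurable

theorem clm_biotSavart {ω : Plane → ℝ} (hω : Continuous ω)
    (hc : HasCompactSupport ω) (x : Plane) (L : Plane →L[ℝ] ℝ) :
    L (biotSavart ω x) = 1 / (2 * π) * ∫ y, ω y / ‖x - y‖ ^ 2 * L (perp (x - y)) := by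
  rw [biotSavart, map_smul, ← L.integral_comp_comm (integrable_biotSavart_integrand hω hc x)]
  simp

theorem integrable_clm_biotSavart_integrand {ω : Plane → ℝ} (hω : Continuous ω)
    (hc : HasCompactSupport ω) {α : Plane → Plane →L[ℝ] ℝ} (hα : Continuous α)
    (hαc : HasCompactSupport α) :
    Integrable (fun p : Plane × Plane => ω p.2 / ‖p.1 - p.2‖ ^ 2 * α p.1 (perp (p.1 - p.2)))
      (volume.prod volume) := by
  obtain ⟨B, hB⟩ := hα.bounded_above_of_compact_support hαc
  obtain ⟨r, hr⟩ := hc.isBounded.exists_norm_le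
  obtain ⟨q, hq⟩ := hαc.isBounded.exists_norm_le
  have hconv := ((hω.integrable_of_hasCompactSupport (μ := volume) hc).convolution_integrand
    (ContinuousLinearMap.mul ℝ ℝ) (integrable_truncatedInv (q + r + 1))).norm.const_mul B
  refine hconv.mono' ?_ (Eventually.of_forall fun p => ?_)
  · have h1 : Measurable fun p : Plane × Plane => ω p.2 / ‖p.1 - p.2‖ ^ 2 :=
      (hω.measurable.comp measurable_snd).div (by fun_prop)
    have h2 : Continuous fun p : Plane × Plane => α p.1 (perp (p.1 - p.2)) :=
      (hα.comp continuous_fst).clm_apply (by fun_prop)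
    exact (h1.mul h2.measurable).aestronglyMeasurable
  · have hB0 : 0 ≤ B := (norm_nonneg _).trans (hB 0)
    by_cases hy : ω p.2 = 0
    · simp [hy]
    by_cases hx : α p.1 = 0
    · simp only [hx, zero_apply, mul_zero, norm_zero]
      positivity
    have hlt : ‖p.1 - p.2‖ < q + r + 1 := by
      have h1 := hr _ (subset_tsupport ω hy)
      have h2 := hq _ (subset_tsupport α hx)
      linarith [norm_sub_le p.1 p.2]
    simp only [ContinuousLinearMap.mul_apply', norm_mul, truncatedInv_of_lt hlt, norm_inv,
      norm_norm]
    have h3 : ‖α p.1 (perp (p.1 - p.2))‖ ≤ B * ‖p.1 - p.2‖ :=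
      ((α p.1).le_opNorm _).trans (by rw [norm_perp]; gcongr; exact hB _)
    refine (mul_le_mul_of_nonneg_left h3 (norm_nonneg _)).trans (le_of_eq ?_)
    rw [norm_div, norm_pow, norm_norm]
    rcases eq_or_ne ‖p.1 - p.2‖ 0 with h | h
    · simp [h]
    · field_simp

theorem integrable_clm_biotSavart {ω : Plane → ℝ} (hω : Continuous ω)
    (hc : HasCompactSupport ω) {α : Plane → Plane →L[ℝ] ℝ} (hα : Continuous α)
    (hαc : HasCompactSupport α) : Integrable fun x => α x (biotSavart ω x) := by
  simp only [clm_biotSavart hω hc]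
  exact (integrable_clm_biotSavart_integrand hω hc hα hαc).integral_prod_left.const_mul _

theorem integral_fderiv_perp_mul_inv_eq_zero {φ : Plane → ℝ} (hφ : ContDiff ℝ 1 φ)
    (hc : HasCompactSupport φ) {ε : ℝ} (hε : 0 < ε) :
    ∫ z, fderiv ℝ φ z (perp z) * (‖z‖ ^ 2 + ε)⁻¹ = 0 := by
  set g : Plane → ℝ := fun z => (‖z‖ ^ 2 + ε)⁻¹ with hg
  have hpos : ∀ z : Plane, ‖z‖ ^ 2 + ε ≠ 0 := fun z => by positivity
  have hgd : ContDiff ℝ 1 g := ((contDiff_norm_sq ℝ).add contDiff_const).inv hpos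
  have hg' : ∀ z v : Plane, fderiv ℝ g z v = -(2 * inner ℝ z v) / (‖z‖ ^ 2 + ε) ^ 2 := by
    intro z v
    have h1 := (hasDerivAt_inv (hpos z)).comp_hasFDerivAt z
      ((hasStrictFDerivAt_norm_sq z).hasFDerivAt.add_const ε)
    rw [hg, show (fun z : Plane => (‖z‖ ^ 2 + ε)⁻¹) = Inv.inv ∘ fun z => ‖z‖ ^ 2 + ε from rfl,
      h1.fderiv]
    simp
    ring
  have hφ' := hφ.continuous_fderiv one_ne_zero
  have ibp : ∀ (i j : Fin 2), i ≠ j → Integrable (fun z : Plane =>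
        φ z * (z j * (-(2 * z i) / (‖z‖ ^ 2 + ε) ^ 2))) ∧
      Integrable (fun z : Plane => fderiv ℝ φ z (EuclideanSpace.single i 1) * (z j * g z)) ∧
      ∫ z : Plane, φ z * (z j * (-(2 * z i) / (‖z‖ ^ 2 + ε) ^ 2)) =
        - ∫ z : Plane, fderiv ℝ φ z (EuclideanSpace.single i 1) * (z j * g z) := by
    intro i j hij
    have hd : ContDiff ℝ 1 fun z : Plane => z j * g z :=
      (EuclideanSpace.proj j : Plane →L[ℝ] ℝ).contDiff.mul hgd
    have hder : ∀ z : Plane, fderiv ℝ (fun z : Plane => z j * g z) z (EuclideanSpace.single i 1) =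
        z j * (-(2 * z i) / (‖z‖ ^ 2 + ε) ^ 2) := by
      intro z
      have h1 : HasFDerivAt (fun z : Plane => z j * g z) _ z :=
        (EuclideanSpace.proj j : Plane →L[ℝ] ℝ).hasFDerivAt.mul
          ((hgd.differentiable one_ne_zero z).hasFDerivAt)
      rw [h1.fderiv]
      simp [hg', EuclideanSpace.inner_single_right, hij.symm]
    have i1 : Integrable fun z : Plane => fderiv ℝ φ z (EuclideanSpace.single i 1) * (z j * g z) :=
      ((hφ'.clm_apply continuous_const).mul hd.continuous).integrable_of_hasCompactSupport
        ((hc.fderiv_apply (𝕜 := ℝ) _).mul_right)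
    have i2 : Integrable fun z : Plane => φ z *
        fderiv ℝ (fun z : Plane => z j * g z) z (EuclideanSpace.single i 1) :=
      (hφ.continuous.mul ((hd.continuous_fderiv one_ne_zero).clm_apply continuous_const)
        ).integrable_of_hasCompactSupport hc.mul_right
    have i3 : Integrable fun z : Plane => φ z * (z j * g z) :=
      (hφ.continuous.mul hd.continuous).integrable_of_hasCompactSupport hc.mul_right
    have h := integral_mul_fderiv_eq_neg_fderiv_mul_of_integrable i1 i2 i3
      (fun z _ => hφ.differentiable one_ne_zero z) (fun z _ => hd.differentiable one_ne_zero z)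
    simp only [hder] at h i2
    exact ⟨i2, i1, h⟩
  obtain ⟨-, a2, a3⟩ := ibp 0 1 (by decide)
  obtain ⟨-, b2, b3⟩ := ibp 1 0 (by decide)
  have hsplit : ∀ z : Plane, fderiv ℝ φ z (perp z) * g z =
      fderiv ℝ φ z (EuclideanSpace.single 1 1) * (z 0 * g z) -
      fderiv ℝ φ z (EuclideanSpace.single 0 1) * (z 1 * g z) := by
    intro z
    rw [perp_eq, map_add, map_smul, map_smul, smul_eq_mul, smul_eq_mul]
    ring
  change ∫ z, fderiv ℝ φ z (perp z) * g z = 0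
  simp only [hsplit]
  rw [integral_sub b2 a2, ← neg_eq_iff_eq_neg.2 b3, ← neg_eq_iff_eq_neg.2 a3, sub_eq_zero, neg_inj]
  refine integral_congr_ae (Eventually.of_forall fun z => ?_)
  ring

theorem integral_fderiv_perp_div_norm_sq_eq_zero {φ : Plane → ℝ} (hφ : ContDiff ℝ 1 φ)
    (hc : HasCompactSupport φ) : ∫ z, fderiv ℝ φ z (perp z) / ‖z‖ ^ 2 = 0 := by
  have hφ' := hφ.continuous_fderiv one_ne_zero
  obtain ⟨B, hB⟩ := hφ'.bounded_above_of_compact_support (hc.fderiv (𝕜 := ℝ))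
  obtain ⟨q, hq⟩ := (hc.fderiv (𝕜 := ℝ)).isBounded.exists_norm_le
  have hlim := tendsto_integral_of_dominated_convergence (μ := volume)
    (F := fun (n : ℕ) z => fderiv ℝ φ z (perp z) * (‖z‖ ^ 2 + 1 / ((n : ℝ) + 1))⁻¹)
    (f := fun z => fderiv ℝ φ z (perp z) / ‖z‖ ^ 2)
    (fun z => B * truncatedInv (q + 1) z)
    (fun n => ((hφ'.clm_apply continuous_perp).measurable.mul
      (by fun_prop)).aestronglyMeasurable)
    ((integrable_truncatedInv (q + 1)).const_mul B)
    (fun n => Eventually.of_forall fun z => by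
      by_cases hz : fderiv ℝ φ z = 0
      · simp only [hz, zero_apply, zero_mul, norm_zero]
        exact mul_nonneg ((norm_nonneg _).trans (hB 0)) (truncatedInv_nonneg _ _)
      rw [truncatedInv_of_lt ((hq z (subset_tsupport _ hz)).trans_lt (lt_add_one q))]
      rcases eq_or_ne z 0 with rfl | hz0
      · have : perp (0 : Plane) = 0 := by rw [← norm_eq_zero, norm_perp, norm_zero]
        simp [this]
      have hzn : 0 < ‖z‖ := norm_pos_iff.2 hz0
      have h1 : ‖fderiv ℝ φ z (perp z)‖ ≤ B * ‖z‖ :=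
        ((fderiv ℝ φ z).le_opNorm _).trans (by rw [norm_perp]; gcongr; exact hB _)
      have h2 : (‖z‖ ^ 2 + 1 / ((n : ℝ) + 1))⁻¹ ≤ (‖z‖ ^ 2)⁻¹ :=
        inv_anti₀ (by positivity) (le_add_of_nonneg_right (by positivity))
      rw [norm_mul, norm_inv, Real.norm_of_nonneg (by positivity : 0 ≤ ‖z‖ ^ 2 + 1 / ((n : ℝ) + 1))]
      refine (mul_le_mul h1 h2 (by positivity) ((norm_nonneg _).trans h1)).trans (le_of_eq ?_)
      field_simp)
    (Eventually.of_forall fun z => by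
      rcases eq_or_ne z 0 with rfl | hz0
      · have : perp (0 : Plane) = 0 := by rw [← norm_eq_zero, norm_perp, norm_zero]
        simp [this]
      rw [div_eq_mul_inv]
      refine Tendsto.const_mul _ (Tendsto.inv₀ ?_ (by simpa using hz0))
      simpa using (tendsto_one_div_add_atTop_nhds_zero_nat (𝕜 := ℝ)).const_add (‖z‖ ^ 2))
  refine tendsto_nhds_unique hlim (tendsto_const_nhds.congr fun n => ?_)
  exact (integral_fderiv_perp_mul_inv_eq_zero hφ hc (by positivity)).symm

/-- The Biot–Savart velocity is weakly divergence free. -/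
theorem integral_fderiv_biotSavart_eq_zero {φ ω : Plane → ℝ} (hφ : ContDiff ℝ 1 φ)
    (hφc : HasCompactSupport φ) (hω : Continuous ω) (hc : HasCompactSupport ω) :
    ∫ x, fderiv ℝ φ x (biotSavart ω x) = 0 := by
  simp only [clm_biotSavart hω hc]
  rw [integral_const_mul, integral_integral_swap (integrable_clm_biotSavart_integrand hω hc
    (hφ.continuous_fderiv one_ne_zero) (hφc.fderiv (𝕜 := ℝ)))]
  have hinner : ∀ y : Plane, ∫ x, ω y / ‖x - y‖ ^ 2 * fderiv ℝ φ x (perp (x - y)) = 0 := by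
    intro y
    have h1 := integral_fderiv_perp_div_norm_sq_eq_zero (φ := fun z => φ (z + y))
      (hφ.comp (contDiff_id.add contDiff_const))
      (hφc.comp_homeomorph (Homeomorph.addRight y))
    rw [← integral_sub_right_eq_self _ y] at h1
    simp only [fderiv_comp_add_right, sub_add_cancel] at h1
    have h2 : ∀ x, ω y / ‖x - y‖ ^ 2 * fderiv ℝ φ x (perp (x - y)) =
        ω y * (fderiv ℝ φ x (perp (x - y)) / ‖x - y‖ ^ 2) := fun x => by ring
    simp only [h2]
    rw [integral_const_mul, h1, mul_zero]
  simp [hinner]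

@[simp] theorem reflect₁_apply_zero (z : Plane) : reflect₁ z 0 = -(z 0) := rfl

@[simp] theorem reflect₁_apply_one (z : Plane) : reflect₁ z 1 = z 1 := rfl

@[simp] theorem reflect₂_apply_zero (z : Plane) : reflect₂ z 0 = z 0 := rfl

@[simp] theorem reflect₂_apply_one (z : Plane) : reflect₂ z 1 = -(z 1) := rfl

@[simp] theorem reflect₁_reflect₁ (z : Plane) : reflect₁ (reflect₁ z) = z := by
  ext i
  fin_cases i <;> simp

@[simp] theorem reflect₂_reflect₂ (z : Plane) : reflect₂ (reflect₂ z) = z := by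
  ext i
  fin_cases i <;> simp

/-- `reflect₁` as a linear isometry. -/
def reflect₁Isometry : Plane ≃ₗᵢ[ℝ] Plane where
  toLinearEquiv := LinearEquiv.ofInvolutive
    { toFun := reflect₁
      map_add' := fun x y => by ext i; fin_cases i <;> simp [add_comm]
      map_smul' := fun c x => by ext i; fin_cases i <;> simp } reflect₁_reflect₁
  norm_map' x := by
    change ‖reflect₁ x‖ = ‖x‖
    rw [← sq_eq_sq₀ (norm_nonneg _) (norm_nonneg _), Plane.norm_sq, Plane.norm_sq]
    simp

/-- `reflect₂` as a linear isometry. -/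
def reflect₂Isometry : Plane ≃ₗᵢ[ℝ] Plane where
  toLinearEquiv := LinearEquiv.ofInvolutive
    { toFun := reflect₂
      map_add' := fun x y => by ext i; fin_cases i <;> simp [add_comm]
      map_smul' := fun c x => by ext i; fin_cases i <;> simp } reflect₂_reflect₂
  norm_map' x := by
    change ‖reflect₂ x‖ = ‖x‖
    rw [← sq_eq_sq₀ (norm_nonneg _) (norm_nonneg _), Plane.norm_sq, Plane.norm_sq]
    simp

theorem measurePreserving_reflect₁ : MeasurePreserving reflect₁ :=
  reflect₁Isometry.measurePreserving

theorem measurableEmbedding_reflect₁ : MeasurableEmbedding reflect₁ :=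
  reflect₁Isometry.toHomeomorph.measurableEmbedding

theorem measurePreserving_reflect₂ : MeasurePreserving reflect₂ :=
  reflect₂Isometry.measurePreserving

theorem measurableEmbedding_reflect₂ : MeasurableEmbedding reflect₂ :=
  reflect₂Isometry.toHomeomorph.measurableEmbedding

theorem isOpen_quadrant : IsOpen Quadrant := by
  have h0 : IsOpen {x : Plane | 0 < x 0} := isOpen_lt continuous_const (by fun_prop)
  have h1 : IsOpen {x : Plane | 0 < x 1} := isOpen_lt continuous_const (by fun_prop)
  exact h0.inter h1

theorem measurableSet_quadrant : MeasurableSet Quadrant := isOpen_quadrant.measurableSet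

/-- An integrable function supported in the open upper half plane and vanishing on the vertical
axis can be folded onto the first quadrant. -/
theorem integral_eq_setIntegral_quadrant {G : Plane → ℝ} (hG : Integrable G)
    (hsupp : ∀ y, G y ≠ 0 → y 0 ≠ 0 ∧ 0 < y 1) :
    ∫ y, G y = ∫ y in Quadrant, (G y + G (reflect₁ y)) := by
  have hGr : Integrable fun y => G (reflect₁ y) :=
    (measurePreserving_reflect₁.integrable_comp_emb measurableEmbedding_reflect₁).2 hG
  have hm : MeasurableSet {y : Plane | 0 < y 0} :=
    (isOpen_lt continuous_const (by fun_prop)).measurableSet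
  have h1 : ∫ y in {y : Plane | 0 < y 0}, G y = ∫ y in Quadrant, G y := by
    refine setIntegral_eq_of_subset_of_forall_sdiff_eq_zero hm (fun y hy => hy.1) fun y hy => ?_
    by_contra hne
    exact hy.2 ⟨hy.1, (hsupp y hne).2⟩
  have h2 : ∫ y in {y : Plane | 0 < y 0}ᶜ, G y = ∫ y in Quadrant, G (reflect₁ y) := by
    have h3 : ∫ y in {y : Plane | 0 < y 0}ᶜ, G y = ∫ y in reflect₁ ⁻¹' Quadrant, G y := by
      refine setIntegral_eq_of_subset_of_forall_sdiff_eq_zero hm.compl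
        (fun y hy => ?_) fun y hy => ?_
      · have := hy.1
        simp only [reflect₁_apply_zero] at this
        simp only [mem_compl_iff, mem_ofPred_eq]
        linarith
      · by_contra hne
        obtain ⟨h0, h1⟩ := hsupp y hne
        have h4 : ¬ 0 < y 0 := hy.1
        refine hy.2 ⟨?_, h1⟩
        simp only [reflect₁_apply_zero]
        rcases lt_or_gt_of_ne h0 with h | h
        · linarith
        · exact absurd h h4
    rw [h3, ← measurePreserving_reflect₁.setIntegral_preimage_emb measurableEmbedding_reflect₁
      (fun y => G (reflect₁ y)) Quadrant]
    simp
  rw [← integral_add_compl hm hG, h1, h2, integral_add hG.integrableOn hGr.integrableOn]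

/-- The folded Biot–Savart kernel on the quadrant. -/
def quadrantKernel (x y : Plane) : ℝ :=
  (x 0 * y 0 * (x 1 + y 1)) / (‖x - reflect₂ y‖ ^ 2 * ‖x + y‖ ^ 2)

theorem quadrantKernel_pos {x y : Plane} (hx : x ∈ Quadrant) (hy : y ∈ Quadrant) :
    0 < quadrantKernel x y := by
  obtain ⟨hx0, hx1⟩ := hx
  obtain ⟨hy0, hy1⟩ := hy
  have h1 : 0 < ‖x - reflect₂ y‖ ^ 2 := by
    rw [Plane.norm_sq]
    simp only [PiLp.sub_apply, reflect₂_apply_zero, reflect₂_apply_one, sub_neg_eq_add]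
    positivity
  have h2 : 0 < ‖x + y‖ ^ 2 := by
    rw [Plane.norm_sq]
    simp only [PiLp.add_apply]
    positivity
  rw [quadrantKernel]
  positivity

theorem quadrantKernel_reflect₁ (x y : Plane) :
    quadrantKernel (reflect₁ x) y = -quadrantKernel x y := by
  simp only [quadrantKernel, Plane.norm_sq, PiLp.sub_apply, PiLp.add_apply, reflect₂_apply_zero,
    reflect₂_apply_one, reflect₁_apply_zero, reflect₁_apply_one]
  rw [show (-x 0 - y 0) ^ 2 = (x 0 + y 0) ^ 2 by ring,
    show (-x 0 + y 0) ^ 2 = (x 0 - y 0) ^ 2 by ring, ← neg_div, sub_neg_eq_add]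
  congr 1
  · ring
  · ring

/-- Horizontal velocity of the Biot–Savart field of a vorticity with the odd symmetry. -/
theorem integrableOn_and_biotSavart_apply_zero {f : Plane → ℝ} (hf : Continuous f)
    (hc : HasCompactSupport f) (hodd : ∀ x, f (reflect₁ x) = -f x)
    (hsupp : ∀ x, f x ≠ 0 → 0 < x 1) {x : Plane} (hx : 0 < x 1) :
    IntegrableOn (fun y => quadrantKernel x y * f y) Quadrant ∧
    biotSavart (fun y => f (reflect₂ y)) x 0 =
      -((2 / π) * ∫ y in Quadrant, quadrantKernel x y * f y) := by
  have hf2 : Continuous fun y => f (reflect₂ y) := hf.comp reflect₂Isometry.continuous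
  have hc2 : HasCompactSupport fun y => f (reflect₂ y) :=
    hc.comp_homeomorph reflect₂Isometry.toHomeomorph
  set G : Plane → ℝ := fun y => f y / ‖x - reflect₂ y‖ ^ 2 * (x 1 + y 1) with hGdef
  have hGG : ∀ y, f (reflect₂ y) / ‖x - y‖ ^ 2 * perp (x - y) 0 = -G (reflect₂ y) := by
    intro y
    simp only [hGdef, perp_apply_zero, PiLp.sub_apply, reflect₂_reflect₂, reflect₂_apply_one]
    ring
  have hG : Integrable G := by
    have h1 := (EuclideanSpace.proj 0 : Plane →L[ℝ] ℝ).integrable_comp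
      (integrable_biotSavart_integrand hf2 hc2 x)
    simp only [map_smul, smul_eq_mul] at h1
    have h2 : Integrable fun y => G (reflect₂ y) := by
      refine h1.neg.congr (Eventually.of_forall fun y => ?_)
      exact neg_eq_iff_eq_neg.2 (hGG y)
    exact (measurePreserving_reflect₂.integrable_comp_emb measurableEmbedding_reflect₂).1 h2
  have hGr : Integrable fun y => G (reflect₁ y) :=
    (measurePreserving_reflect₁.integrable_comp_emb measurableEmbedding_reflect₁).2 hG
  have hf0 : ∀ y : Plane, y 0 = 0 → f y = 0 := by
    intro y hy
    have h1 : reflect₁ y = y := by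
      ext i
      fin_cases i <;> simp [hy]
    have h2 := hodd y
    rw [h1] at h2
    linarith
  have hfold : ∀ y ∈ Quadrant, G y + G (reflect₁ y) = 4 * (quadrantKernel x y * f y) := by
    intro y hy
    have hpos : 0 < x 1 + y 1 := add_pos hx hy.2
    have h1 : (x 0 - y 0) ^ 2 + (x 1 + y 1) ^ 2 ≠ 0 := by positivity
    have h2 : (x 0 + y 0) ^ 2 + (x 1 + y 1) ^ 2 ≠ 0 := by positivity
    simp only [hGdef, quadrantKernel, hodd, Plane.norm_sq, PiLp.sub_apply, PiLp.add_apply,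
      reflect₂_apply_zero, reflect₂_apply_one, reflect₁_apply_zero, reflect₁_apply_one,
      sub_neg_eq_add]
    field_simp
    ring
  have hint : IntegrableOn (fun y => 4 * (quadrantKernel x y * f y)) Quadrant :=
    (hG.integrableOn.add hGr.integrableOn).congr_fun hfold measurableSet_quadrant
  refine ⟨?_, ?_⟩
  · have := hint.const_mul (1 / 4)
    refine this.congr (Eventually.of_forall fun y => ?_)
    ring
  · have h : biotSavart (fun y => f (reflect₂ y)) x 0 =
        1 / (2 * π) * ∫ y, f (reflect₂ y) / ‖x - y‖ ^ 2 * perp (x - y) 0 :=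
      clm_biotSavart hf2 hc2 x (EuclideanSpace.proj 0 : Plane →L[ℝ] ℝ)
    simp only [hGG] at h
    rw [h, integral_neg, measurePreserving_reflect₂.integral_comp measurableEmbedding_reflect₂ G,
      integral_eq_setIntegral_quadrant hG, setIntegral_congr_fun measurableSet_quadrant hfold,
      integral_const_mul]
    · field_simp
      ring
    · intro y hy
      have hfy : f y ≠ 0 := fun h => hy (by simp [hGdef, h])
      exact ⟨fun h => hfy (hf0 y h), hsupp y hfy⟩

theorem integrableOn_quadrant_pairing {f : Plane → ℝ} (hf : Continuous f)
    (hc : HasCompactSupport f) (hodd : ∀ x, f (reflect₁ x) = -f x)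
    (hsupp : ∀ x, f x ≠ 0 → 0 < x 1) :
    IntegrableOn (fun x => ∫ y in Quadrant, quadrantKernel x y * f y * f x) Quadrant ∧
    ∫ x, f x * biotSavart (fun y => f (reflect₂ y)) x 0 =
      -(2 * ((2 / π) * ∫ x in Quadrant, ∫ y in Quadrant, quadrantKernel x y * f y * f x)) := by
  have hf2 : Continuous fun y => f (reflect₂ y) := hf.comp reflect₂Isometry.continuous
  have hc2 : HasCompactSupport fun y => f (reflect₂ y) :=
    hc.comp_homeomorph reflect₂Isometry.toHomeomorph
  set u : Plane → ℝ := fun x => biotSavart (fun y => f (reflect₂ y)) x 0 with hu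
  have hint : Integrable fun x => f x * u x := by
    have := integrable_clm_biotSavart hf2 hc2
      (α := fun x => f x • (EuclideanSpace.proj 0 : Plane →L[ℝ] ℝ))
      (hf.smul continuous_const) hc.smul_right
    simpa using this
  have hux : ∀ x : Plane, 0 < x 1 → u x =
      -((2 / π) * ∫ y in Quadrant, quadrantKernel x y * f y) := fun x hx =>
    (integrableOn_and_biotSavart_apply_zero hf hc hodd hsupp hx).2
  have hur : ∀ x ∈ Quadrant, u (reflect₁ x) = - u x := by
    intro x hx
    rw [hux x hx.2, hux (reflect₁ x) hx.2]
    simp only [quadrantKernel_reflect₁, neg_mul, integral_neg, mul_neg]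
  have hfu : ∀ x ∈ Quadrant, f x * u x =
      -(2 / π) * ∫ y in Quadrant, quadrantKernel x y * f y * f x := by
    intro x hx
    rw [hux x hx.2, integral_mul_const]
    ring
  have hf0 : ∀ y : Plane, y 0 = 0 → f y = 0 := by
    intro y hy
    have h1 : reflect₁ y = y := by
      ext i
      fin_cases i <;> simp [hy]
    have h2 := hodd y
    rw [h1] at h2
    linarith
  refine ⟨?_, ?_⟩
  · have h := (hint.integrableOn.congr_fun hfu measurableSet_quadrant).const_mul (-(π / 2))
    refine IntegrableOn.congr_fun h (fun x _ => ?_) measurableSet_quadrant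
    have hcancel : ∀ I : ℝ, -(π / 2) * (-(2 / π) * I) = I := fun I => by field_simp
    exact hcancel _
  · rw [integral_eq_setIntegral_quadrant hint fun y hy => ⟨fun h => hy (by simp [hf0 y h]),
      hsupp y fun h => hy (by simp [h])⟩]
    rw [setIntegral_congr_fun measurableSet_quadrant (g := fun x =>
      2 * (-(2 / π) * ∫ y in Quadrant, quadrantKernel x y * f y * f x))]
    · rw [integral_const_mul, integral_const_mul]
      ring
    · intro x hx
      simp only
      rw [hur x hx, hodd, ← hfu x hx]
      ring

theorem quadrant_pairing_pos {f : Plane → ℝ} (hf : Continuous f)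
    (hc : HasCompactSupport f) (hodd : ∀ x, f (reflect₁ x) = -f x)
    (hsupp : ∀ x, f x ≠ 0 → 0 < x 1)
    (hsign : (∀ x ∈ Quadrant, f x ≤ 0) ∨ ∀ x ∈ Quadrant, 0 ≤ f x)
    (hne : ∃ x ∈ Quadrant, f x ≠ 0) :
    0 < ∫ x in Quadrant, ∫ y in Quadrant, quadrantKernel x y * f y * f x := by
  have hprod : ∀ x ∈ Quadrant, ∀ y ∈ Quadrant, 0 ≤ f y * f x := by
    rcases hsign with h | h
    · exact fun x hx y hy => mul_nonneg_of_nonpos_of_nonpos (h y hy) (h x hx)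
    · exact fun x hx y hy => mul_nonneg (h y hy) (h x hx)
  have hnn : ∀ x ∈ Quadrant, ∀ y ∈ Quadrant, 0 ≤ quadrantKernel x y * f y * f x := by
    intro x hx y hy
    rw [mul_assoc]
    exact mul_nonneg (quadrantKernel_pos hx hy).le (hprod x hx y hy)
  set S : Set Plane := {x | f x ≠ 0} ∩ Quadrant with hS
  have hSpos : 0 < volume S := by
    obtain ⟨x, hx, hfx⟩ := hne
    exact ((isOpen_ne_fun hf continuous_const).inter isOpen_quadrant).measure_pos volume
      ⟨x, hfx, hx⟩
  have hinner : ∀ x ∈ S, 0 < ∫ y in Quadrant, quadrantKernel x y * f y * f x := by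
    intro x hx
    rw [setIntegral_pos_iff_support_of_nonneg_ae
      ((ae_restrict_iff' measurableSet_quadrant).2 (Eventually.of_forall (hnn x hx.2)))
      ((integrableOn_and_biotSavart_apply_zero hf hc hodd hsupp hx.2.2).1.mul_const _)]
    refine hSpos.trans_le (measure_mono fun y hy => ⟨?_, hy.2⟩)
    exact mul_ne_zero (mul_ne_zero (quadrantKernel_pos hx.2 hy.2).ne' hy.1) hx.1
  rw [setIntegral_pos_iff_support_of_nonneg_ae
    ((ae_restrict_iff' measurableSet_quadrant).2 (Eventually.of_forall fun x hx =>
      setIntegral_nonneg measurableSet_quadrant (hnn x hx)))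
    (integrableOn_quadrant_pairing hf hc hodd hsupp).1]
  exact hSpos.trans_le (measure_mono fun x hx => ⟨(hinner x hx).ne', hx.2⟩)

/-- Differentiation under the integral sign of the first horizontal moment over a ball. -/
theorem hasDerivAt_setIntegral_moment {σ : ℝ → Plane → ℝ}
    (hσ : ContDiff ℝ 1 fun p : ℝ × Plane => σ p.1 p.2) (r t : ℝ) :
    HasDerivAt (fun s => ∫ x in Metric.closedBall (0 : Plane) r, x 0 * σ s x)
      (∫ x in Metric.closedBall (0 : Plane) r, x 0 * deriv (fun s => σ s x) t) t := by
  have hd : ∀ s x, HasDerivAt (fun s => σ s x)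
      (fderiv ℝ (fun p : ℝ × Plane => σ p.1 p.2) (s, x) (1, 0)) s := by
    intro s x
    have h1 := (hσ.differentiable one_ne_zero (s, x)).hasFDerivAt
    have h2 : HasDerivAt (fun s : ℝ => (s, x)) ((1 : ℝ), (0 : Plane)) s :=
      (hasDerivAt_id s).prodMk (hasDerivAt_const s x)
    exact h1.comp_hasDerivAt s h2
  have hdc : Continuous fun p : ℝ × Plane =>
      p.2 0 * deriv (fun s => σ s p.2) p.1 := by
    simp only [fun s x => (hd s x).deriv]
    have := (hσ.continuous_fderiv one_ne_zero).clm_apply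
      (continuous_const (y := ((1 : ℝ), (0 : Plane))))
    fun_prop
  have hσx : ∀ s, Continuous (σ s) := fun s =>
    hσ.continuous.comp (by fun_prop : Continuous fun x : Plane => (s, x))
  obtain ⟨M, hM⟩ := ((isCompact_closedBall t 1).prod
    (isCompact_closedBall (0 : Plane) r)).exists_bound_of_continuousOn hdc.continuousOn
  have hfin : IsFiniteMeasure (volume.restrict (Metric.closedBall (0 : Plane) r)) :=
    ⟨by simpa using measure_closedBall_lt_top (μ := volume) (x := (0 : Plane)) (r := r)⟩
  refine (hasDerivAt_integral_of_dominated_loc_of_deriv_le (bound := fun _ => M)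
    (F' := fun s x => x 0 * deriv (fun s => σ s x) s)
    (Metric.closedBall_mem_nhds t one_pos) (Eventually.of_forall fun s => ?_) ?_ ?_ ?_
    (integrable_const M) (Eventually.of_forall fun x s _ => ?_)).2
  · have := hσx s
    exact (by fun_prop : Continuous fun x : Plane => x 0 * σ s x).aestronglyMeasurable
  · have := hσx t
    exact (by fun_prop : Continuous fun x : Plane => x 0 * σ t x).continuousOn.integrableOn_compact
      (μ := volume) (isCompact_closedBall _ _)
  · exact (hdc.comp (by fun_prop : Continuous fun x : Plane => (t, x))).aestronglyMeasurable
  · refine (ae_restrict_iff' Metric.isClosed_closedBall.measurableSet).2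
      (Eventually.of_forall fun x hx s hs => hM (s, x) ⟨hs, hx⟩)
  · rw [(hd s x).deriv]
    exact (hd s x).const_mul _

/-- Integration by parts for the first horizontal moment of a scalar advected by a Biot–Savart
field. -/
theorem integral_moment_fderiv_biotSavart {f ω : Plane → ℝ} (hf : ContDiff ℝ 1 f)
    (hfc : HasCompactSupport f) (hω : Continuous ω) (hc : HasCompactSupport ω) :
    ∫ x : Plane, x 0 * fderiv ℝ f x (biotSavart ω x) = -∫ x, f x * biotSavart ω x 0 := by
  have hφ : ContDiff ℝ 1 fun x : Plane => x 0 * f x :=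
    (EuclideanSpace.proj 0 : Plane →L[ℝ] ℝ).contDiff.mul hf
  have hφc : HasCompactSupport fun x : Plane => x 0 * f x := hfc.mul_left
  have hder : ∀ x v : Plane, fderiv ℝ (fun x : Plane => x 0 * f x) x v =
      x 0 * fderiv ℝ f x v + f x * v 0 := by
    intro x v
    have h1 : HasFDerivAt (fun x : Plane => x 0 * f x) _ x :=
      (EuclideanSpace.proj 0 : Plane →L[ℝ] ℝ).hasFDerivAt.mul
        (hf.differentiable one_ne_zero x).hasFDerivAt
    rw [h1.fderiv]
    simp
  have h0 := integral_fderiv_biotSavart_eq_zero hφ hφc hω hc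
  have i1 := integrable_clm_biotSavart hω hc (hφ.continuous_fderiv one_ne_zero)
    (hφc.fderiv (𝕜 := ℝ))
  have i2 : Integrable fun x => f x * biotSavart ω x 0 := by
    have := integrable_clm_biotSavart hω hc
      (α := fun x => f x • (EuclideanSpace.proj 0 : Plane →L[ℝ] ℝ))
      (hf.continuous.smul continuous_const) hfc.smul_right
    simpa using this
  have h3 := integral_sub i1 i2
  rw [h0, zero_sub] at h3
  rw [← h3]
  refine integral_congr_ae (Eventually.of_forall fun x => ?_)
  simp only [hder]
  ring

/-- A continuous compactly supported function, odd in `x₁` and supported in the upper half plane: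
its first moment over the quadrant is half of the moment over a ball containing the support. -/
theorem setIntegral_quadrant_moment {f : Plane → ℝ} (hf : Continuous f)
    (hc : HasCompactSupport f) (hodd : ∀ x, f (reflect₁ x) = -f x)
    (hsupp : ∀ x, f x ≠ 0 → 0 < x 1) {r : ℝ} (hr : VanishesBeyond f r) :
    ∫ x in Quadrant, x 0 * f x =
      (1 / 2) * ∫ x in Metric.closedBall (0 : Plane) r, x 0 * f x := by
  have hG : Integrable fun x : Plane => x 0 * f x :=
    (by fun_prop : Continuous fun x : Plane => x 0 * f x).integrable_of_hasCompactSupport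
      hc.mul_left
  have hball : ∫ x in Metric.closedBall (0 : Plane) r, x 0 * f x = ∫ x, x 0 * f x :=
    setIntegral_eq_integral_of_forall_compl_eq_zero fun x hx => by
      rw [hr x (by simpa using hx), mul_zero]
  rw [hball, integral_eq_setIntegral_quadrant hG, ← integral_const_mul]
  · refine setIntegral_congr_fun measurableSet_quadrant fun x _ => ?_
    simp only [hodd, reflect₁_apply_zero]
    ring
  · exact fun x hx => ⟨left_ne_zero_of_mul hx, hsupp x (right_ne_zero_of_mul hx)⟩

theorem VanishesBeyond.fderiv_eq_zero {f : Plane → ℝ} {r : ℝ} (hr : VanishesBeyond f r)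
    {x : Plane} (hx : r < ‖x‖) : fderiv ℝ f x = 0 := by
  have h : f =ᶠ[nhds x] fun _ => 0 :=
    Filter.eventually_of_mem ((isOpen_lt continuous_const continuous_norm).mem_nhds hx) hr
  rw [h.fderiv_eq]
  simp

end

/-- Evolution of the first restricted barycenter moment
`E₁(t) = ∫_Q x₁ σ₊(t,x) dx` for smooth solutions of the unscreened right-handed
system with the odd/mirror symmetries, support of `σ₊` in the upper half plane,
and a sign condition on `Q`:
`E₁′(t) = (2/π) ∫_{Q×Q} x₁y₁(x₂+y₂)/(|x−ȳ|²|x+y|²) σ₊(y)σ₊(x) dy dx > 0`. -/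
theorem first_moment_evolution
    (T : ℝ) (hT : 0 < T)
    (σp σm : ℝ → EuclideanSpace ℝ (Fin 2) → ℝ)
    (hsp : ContDiff ℝ (⊤ : ℕ∞) fun p : ℝ × EuclideanSpace ℝ (Fin 2) => σp p.1 p.2)
    (hsm : ContDiff ℝ (⊤ : ℕ∞) fun p : ℝ × EuclideanSpace ℝ (Fin 2) => σm p.1 p.2)
    (hcp : ∀ t, HasCompactSupport (σp t)) (hcm : ∀ t, HasCompactSupport (σm t))
    (hsol : ∀ t ∈ Icc (0:ℝ) T, ∀ x,
      deriv (fun s => σp s x) t - fderiv ℝ (σp t) x (biotSavart (σm t) x) = 0 ∧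
      deriv (fun s => σm s x) t + fderiv ℝ (σm t) x (biotSavart (σp t) x) = 0)
    (hodd : ∀ t ∈ Icc (0:ℝ) T, ∀ x,
      σp t (reflect₁ x) = -σp t x ∧ σm t (reflect₁ x) = -σm t x)
    (hmirror : ∀ t ∈ Icc (0:ℝ) T, ∀ x, σp t x = σm t (reflect₂ x))
    (hsupp : ∀ t ∈ Icc (0:ℝ) T, ∀ x, σp t x ≠ 0 → 0 < x 1)
    (hsign : ∀ t ∈ Icc (0:ℝ) T,
      (∀ x ∈ Quadrant, σp t x ≤ 0) ∨ (∀ x ∈ Quadrant, 0 ≤ σp t x)) :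
    ∀ t ∈ Icc (0:ℝ) T,
      HasDerivWithinAt (fun s => ∫ x in Quadrant, x 0 * σp s x)
        ((2 / π) * ∫ x in Quadrant, ∫ y in Quadrant,
          (x 0 * y 0 * (x 1 + y 1)) / (‖x - reflect₂ y‖ ^ 2 * ‖x + y‖ ^ 2) *
            σp t y * σp t x)
        (Icc (0:ℝ) T) t ∧
      ((¬ ∀ x ∈ Quadrant, σp t x = 0) →
        0 < (2 / π) * ∫ x in Quadrant, ∫ y in Quadrant,
          (x 0 * y 0 * (x 1 + y 1)) / (‖x - reflect₂ y‖ ^ 2 * ‖x + y‖ ^ 2) *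
            σp t y * σp t x) := by
  have hσ : ContDiff ℝ 1 fun p : ℝ × EuclideanSpace ℝ (Fin 2) => σp p.1 p.2 :=
    hsp.of_le (by exact_mod_cast le_top)
  have hσx : ∀ s, ContDiff ℝ 1 (σp s) := fun s =>
    hσ.comp (contDiff_const.prodMk contDiff_id :
      ContDiff ℝ 1 fun x : EuclideanSpace ℝ (Fin 2) => (s, x))
  have hmc : ∀ t, Continuous (σm t) := fun t =>
    hsm.continuous.comp (by fun_prop : Continuous fun x : EuclideanSpace ℝ (Fin 2) => (t, x))
  have hσm : ∀ t ∈ Icc (0:ℝ) T, σm t = fun y => σp t (reflect₂ y) := fun t ht => by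
    funext y
    rw [hmirror t ht, reflect₂_reflect₂]
  have heq : ∀ t ∈ Icc (0:ℝ) T, ∀ x,
      deriv (fun s => σp s x) t = fderiv ℝ (σp t) x (biotSavart (σm t) x) :=
    fun t ht x => sub_eq_zero.1 (hsol t ht x).1
  have htrans : SelfTransported σp (3 / 2) (Icc 0 T) := by
    refine fun t ht => ⟨biotSavart (σm t), heq t ht, fun A ρ hρ hA hv x => ?_⟩
    refine norm_biotSavart_le hρ (fun y => ?_) (fun y hy => ?_) x
    · rw [hσm t ht]
      exact hA _
    · rw [hσm t ht]
      exact hv _ (by rwa [show ‖reflect₂ y‖ = ‖y‖ from reflect₂Isometry.norm_map y])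
  obtain ⟨r, hr⟩ := htrans.exists_vanishesBeyond hσ (by norm_num)
    fun t _ => (hcp t).exists_vanishesBeyond
  intro t ht
  have hoddt : ∀ x, σp t (reflect₁ x) = -σp t x := fun x => (hodd t ht x).1
  have hct := (hσx t).continuous
  refine ⟨?_, fun hne => ?_⟩
  · have hmoment : ∀ s ∈ Icc (0:ℝ) T, ∫ x in Quadrant, x 0 * σp s x =
        (1 / 2) * ∫ x in Metric.closedBall (0 : EuclideanSpace ℝ (Fin 2)) r, x 0 * σp s x :=
      fun s hs => setIntegral_quadrant_moment (hσx s).continuous (hcp s) (fun x => (hodd s hs x).1)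
        (hsupp s hs) (hr s hs)
    have hderiv := (((hasDerivAt_setIntegral_moment hσ r t).const_mul (1 / 2)).hasDerivWithinAt
      (s := Icc (0:ℝ) T)).congr hmoment (hmoment t ht)
    refine hderiv.congr_deriv ?_
    have hvalue : ∫ x in Metric.closedBall (0 : EuclideanSpace ℝ (Fin 2)) r,
          x 0 * deriv (fun s => σp s x) t =
        ∫ x : EuclideanSpace ℝ (Fin 2), x 0 * fderiv ℝ (σp t) x (biotSavart (σm t) x) := by
      simp only [heq t ht]
      refine setIntegral_eq_integral_of_forall_compl_eq_zero fun x hx => ?_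
      rw [VanishesBeyond.fderiv_eq_zero (hr t ht) (by simpa using hx)]
      simp
    rw [hvalue, integral_moment_fderiv_biotSavart (hσx t) (hcp t) (hmc t) (hcm t), hσm t ht,
      (integrableOn_quadrant_pairing hct (hcp t) hoddt (hsupp t ht)).2]
    simp only [quadrantKernel]
    ring
  · push Not at hne
    exact mul_pos (by positivity)
      (quadrant_pairing_pos hct (hcp t) hoddt (hsupp t ht) (hsign t ht) hne)

end
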